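/- The set A' of triples (f1 + g1*eps, f2 + g2*eps, f3 + g3*eps) in (DualNumber R3)^3 such that (y-x) divides f1 - f2, (z-y) divides f2 - f3, (z-x) divides f1 - f3, (y-x) divides g1 - g2, (z-y) divides g2 - g3, (z-x) divides g1 + g3, and moreover (z-y) divides g1, (z-x) divides g2, (y-x) divides g3, is an R3-submodule of (DualNumber R3)^3 which is a free R3-module of rank 6. -/

import Mathlib

open MvPolynomial TrivSqZeroExt

abbrev R3 : Type := MvPolynomial (Fin 3) ℚ

noncomputable abbrev x : R3 := X 0
noncomputable abbrev y : R3 := X 1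
noncomputable abbrev z : R3 := X 2

/-- A polynomial is congruent, modulo `X i - X j`, to the result of replacing `X i` by `X j`. -/
theorem X_sub_X_dvd_sub_aeval_update {σ R : Type*} [DecidableEq σ] [CommRing R] (i j : σ)
    (p : MvPolynomial σ R) :
    (X i - X j) ∣ p - aeval (Function.update X i (X j)) p := by
  rw [← Ideal.mem_span_singleton, ← Ideal.Quotient.mk_eq_mk_iff_sub_mem]
  let π := Ideal.Quotient.mkₐ R (Ideal.span {(X i - X j : MvPolynomial σ R)})
  have h : π = π.comp (aeval (Function.update X i (X j))) := by
    ext k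
    rcases eq_or_ne k i with rfl | hk
    · simp only [AlgHom.comp_apply, aeval_X, Function.update_self]
      exact (Ideal.Quotient.mk_eq_mk_iff_sub_mem _ _).2 (Ideal.mem_span_singleton_self _)
    · simp [hk]
  exact DFunLike.congr_fun h p

theorem X_sub_X_dvd_of_dvd_mul {σ R : Type*} [CommRing R] [IsDomain R] {i j k : σ}
    (hij : i ≠ j) (hik : i ≠ k) (hjk : j ≠ k) {p : MvPolynomial σ R}
    (h : (X i - X j) ∣ (X j - X k) * p) : (X i - X j) ∣ p := by
  classical
  obtain ⟨q, hq⟩ := h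
  have hs := congrArg (aeval (Function.update X i (X j : MvPolynomial σ R))) hq
  simp only [map_mul, map_sub, aeval_X, Function.update_self, Function.update_of_ne hij.symm,
    Function.update_of_ne hik.symm, sub_self, zero_mul] at hs
  have hp := (mul_eq_zero.1 hs).resolve_left
    (sub_ne_zero.2 fun e => hjk (X_injective e))
  have h := X_sub_X_dvd_sub_aeval_update i j p
  rwa [hp, sub_zero] at h

theorem z_sub_y_dvd_of_dvd_mul {p : R3} (h : (z - y) ∣ (y - x) * p) : (z - y) ∣ p :=
  X_sub_X_dvd_of_dvd_mul (by decide) (by decide) (by decide) h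

theorem y_sub_x_dvd_of_dvd_mul {p : R3} (h : (y - x) ∣ (z - x) * p) : (y - x) ∣ p := by
  refine X_sub_X_dvd_of_dvd_mul (k := 2) (by decide) (by decide) (by decide) ?_
  rw [← dvd_neg, ← neg_mul, neg_sub]
  exact h

theorem z_sub_x_dvd_of_dvd_mul {p : R3} (h : (z - x) ∣ (y - x) * p) : (z - x) ∣ p := by
  refine X_sub_X_dvd_of_dvd_mul (k := 1) (by decide) (by decide) (by decide) ?_
  rw [← dvd_neg, ← neg_mul, neg_sub]
  exact h

/-- Triples satisfying the congruences along the edges of the triangle graph. -/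
def IsTriangleCongruent (f₁ f₂ f₃ : R3) : Prop :=
  (y - x) ∣ f₁ - f₂ ∧ (z - y) ∣ f₂ - f₃ ∧ (z - x) ∣ f₁ - f₃

/-- A triple satisfies the triangle congruences iff it has a Newton-type expansion. -/
theorem isTriangleCongruent_iff (f₁ f₂ f₃ : R3) :
    IsTriangleCongruent f₁ f₂ f₃ ↔ ∃ b c : R3,
      f₂ = f₁ + (y - x) * b ∧ f₃ = f₁ + (z - x) * b + (z - x) * (z - y) * c := by
  constructor
  · rintro ⟨⟨b, hb⟩, ⟨d, hd⟩, ⟨e, he⟩⟩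
    obtain ⟨c, hc⟩ : (z - y) ∣ b - e :=
      z_sub_y_dvd_of_dvd_mul ⟨e - d, by linear_combination he - hd - hb⟩
    exact ⟨-b, c, by linear_combination -hb, by linear_combination -he + (z - x) * hc⟩
  · rintro ⟨b, c, rfl, rfl⟩
    exact ⟨⟨-b, by ring⟩, ⟨-b - (z - x) * c, by ring⟩, ⟨-b - (z - y) * c, by ring⟩⟩

/-- The congruences on the `ε`-parts amount to the triangle congruences on their cofactors. -/
theorem snd_congruences_iff (g₁ g₂ g₃ : R3) :
    ((y - x) ∣ g₁ - g₂ ∧ (z - y) ∣ g₂ - g₃ ∧ (z - x) ∣ g₁ + g₃ ∧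
      (z - y) ∣ g₁ ∧ (z - x) ∣ g₂ ∧ (y - x) ∣ g₃) ↔
    ∃ a₁ a₂ a₃ : R3, IsTriangleCongruent a₁ a₂ a₃ ∧
      g₁ = (z - y) * a₁ ∧ g₂ = (z - x) * a₂ ∧ g₃ = (y - x) * a₃ := by
  constructor
  · rintro ⟨⟨u, hu⟩, ⟨v, hv⟩, ⟨w, hw⟩, ⟨a₁, rfl⟩, ⟨a₂, rfl⟩, ⟨a₃, rfl⟩⟩
    refine ⟨a₁, a₂, a₃, ⟨y_sub_x_dvd_of_dvd_mul ⟨u + a₁, ?_⟩,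
      z_sub_y_dvd_of_dvd_mul ⟨v - a₂, ?_⟩, z_sub_x_dvd_of_dvd_mul ⟨a₁ - w, ?_⟩⟩, rfl, rfl, rfl⟩
    · linear_combination hu
    · linear_combination hv
    · linear_combination -hw
  · rintro ⟨a₁, a₂, a₃, ⟨⟨u, hu⟩, ⟨v, hv⟩, ⟨w, hw⟩⟩, rfl, rfl, rfl⟩
    refine ⟨⟨(z - x) * u - a₁, ?_⟩, ⟨(y - x) * v + a₂, ?_⟩, ⟨a₁ - (y - x) * w, ?_⟩,
      dvd_mul_right _ _, dvd_mul_right _ _, dvd_mul_right _ _⟩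
    · linear_combination (z - x) * hu
    · linear_combination (y - x) * hv
    · linear_combination -(y - x) * hw

/-- The parametrization of the congruence module by six free coefficients. -/
noncomputable def congruenceParam :
    (Fin 6 → R3) →ₗ[R3] DualNumber R3 × DualNumber R3 × DualNumber R3 where
  toFun c :=
    ((c 0, (z - y) * c 3),
     (c 0 + (y - x) * c 1, (z - x) * (c 3 + (y - x) * c 4)),
     (c 0 + (z - x) * c 1 + (z - x) * (z - y) * c 2,
      (y - x) * (c 3 + (z - x) * c 4 + (z - x) * (z - y) * c 5)))
  map_add' c d := by
    refine Prod.ext (Prod.ext ?_ ?_) (Prod.ext (Prod.ext ?_ ?_) (Prod.ext ?_ ?_)) <;>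
      simp only [Prod.fst_add, Prod.snd_add, Pi.add_apply] <;>
      first | rfl | (change _ = _ + _; ring)
  map_smul' r c := by
    refine Prod.ext (Prod.ext ?_ ?_) (Prod.ext (Prod.ext ?_ ?_) (Prod.ext ?_ ?_)) <;>
      simp only [Pi.smul_apply, smul_eq_mul, RingHom.id_apply] <;>
      first | rfl | (change _ = r * _; ring)

theorem congruenceParam_injective : Function.Injective congruenceParam := by
  have hyx : y - x ≠ 0 := sub_ne_zero.2 fun e => absurd (X_injective e) (by decide)
  have hzx : z - x ≠ 0 := sub_ne_zero.2 fun e => absurd (X_injective e) (by decide)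
  have hzy : z - y ≠ 0 := sub_ne_zero.2 fun e => absurd (X_injective e) (by decide)
  rw [← LinearMap.ker_eq_bot, LinearMap.ker_eq_bot']
  intro c hc
  have h0 : c 0 = 0 := congrArg (fun q : _ × _ × _ => fst q.1) hc
  have h3 : (z - y) * c 3 = 0 := congrArg (fun q : _ × _ × _ => snd q.1) hc
  have h1 : c 0 + (y - x) * c 1 = 0 := congrArg (fun q : _ × _ × _ => fst q.2.1) hc
  have h4 : (z - x) * (c 3 + (y - x) * c 4) = 0 := congrArg (fun q : _ × _ × _ => snd q.2.1) hc
  have h2 : c 0 + (z - x) * c 1 + (z - x) * (z - y) * c 2 = 0 :=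
    congrArg (fun q : _ × _ × _ => fst q.2.2) hc
  have h5 : (y - x) * (c 3 + (z - x) * c 4 + (z - x) * (z - y) * c 5) = 0 :=
    congrArg (fun q : _ × _ × _ => snd q.2.2) hc
  simp only [h0, zero_add, mul_eq_zero, hyx, hzy, false_or] at h1 h3
  simp only [h3, zero_add, mul_eq_zero, hyx, hzx, false_or] at h4
  simp only [h0, h1, mul_zero, zero_add, mul_eq_zero, hzx, hzy, false_or] at h2
  simp only [h3, h4, mul_zero, zero_add, mul_eq_zero, hyx, hzx, hzy, false_or] at h5
  ext1 i
  fin_cases i <;> assumption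

theorem mem_range_congruenceParam_iff (q : DualNumber R3 × DualNumber R3 × DualNumber R3) :
    q ∈ LinearMap.range congruenceParam ↔
      IsTriangleCongruent (fst q.1) (fst q.2.1) (fst q.2.2) ∧
      ∃ a₁ a₂ a₃ : R3, IsTriangleCongruent a₁ a₂ a₃ ∧
        snd q.1 = (z - y) * a₁ ∧ snd q.2.1 = (z - x) * a₂ ∧ snd q.2.2 = (y - x) * a₃ := by
  simp only [isTriangleCongruent_iff]
  constructor
  · rintro ⟨c, rfl⟩
    exact ⟨⟨c 1, c 2, rfl, rfl⟩, c 3, _, _, ⟨c 4, c 5, rfl, rfl⟩, rfl, rfl, rfl⟩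
  · rintro ⟨⟨b, c, h2, h3⟩, a₁, _, _, ⟨d, e, rfl, rfl⟩, k1, k2, k3⟩
    exact ⟨![fst q.1, b, c, a₁, d, e],
      Prod.ext (Prod.ext rfl k1.symm)
        (Prod.ext (Prod.ext h2.symm k2.symm) (Prod.ext h3.symm k3.symm))⟩

theorem stmt_10 :
    ∃ A : Submodule R3 (DualNumber R3 × DualNumber R3 × DualNumber R3),
      (A : Set (DualNumber R3 × DualNumber R3 × DualNumber R3)) =
        {q : DualNumber R3 × DualNumber R3 × DualNumber R3 |
          (y - x) ∣ fst q.1 - fst q.2.1 ∧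
          (z - y) ∣ fst q.2.1 - fst q.2.2 ∧
          (z - x) ∣ fst q.1 - fst q.2.2 ∧
          (y - x) ∣ snd q.1 - snd q.2.1 ∧
          (z - y) ∣ snd q.2.1 - snd q.2.2 ∧
          (z - x) ∣ snd q.1 + snd q.2.2 ∧
          (z - y) ∣ snd q.1 ∧ (z - x) ∣ snd q.2.1 ∧ (y - x) ∣ snd q.2.2} ∧
      Module.Free R3 ↥A ∧ Module.rank R3 ↥A = 6 := by
  let e := LinearEquiv.ofInjective congruenceParam congruenceParam_injective
  refine ⟨LinearMap.range congruenceParam, ?_, Module.Free.of_equiv e, ?_⟩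
  · ext q
    rw [SetLike.mem_coe, mem_range_congruenceParam_iff, ← snd_congruences_iff]
    simp only [IsTriangleCongruent, Set.mem_ofPred_eq, and_assoc]
  · rw [← e.rank_eq, rank_fin_fun]
    rfl
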